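/- A subspace H_S can be made globally asymptotically stable for the controlled dynamics T_c[ρ] = Σ_k U_k M_k ρ M_k† U_k† by some choice of unitaries {U_k} if and only if not all the blocks R_{P,k} of the canonical R-factors of the M_k (computed relative to the decomposition H = H_S ⊕ H_R) are zero. -/

import Mathlib

open Matrix Filter
open scoped ComplexOrder

/-- The rank of the matrix formed by the first `j` columns of `A`. -/
noncomputable def colRank (n : ℕ) (A : Matrix (Fin n) (Fin n) ℂ) (j : ℕ) : ℕ :=
  Module.finrank ℂ (Submodule.span ℂ ((fun l => Aᵀ l) '' {l : Fin n | (l : ℕ) < j}))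

/-- `A = QR` is a canonical QR decomposition. -/
def IsCanonicalQR (n : ℕ) (A Q R : Matrix (Fin n) (Fin n) ℂ) : Prop :=
  Qᴴ * Q = 1 ∧ A = Q * R ∧
  (∀ i j : Fin n, colRank n A ((j : ℕ) + 1) ≤ (i : ℕ) → R i j = 0) ∧
  (∀ i j : Fin n, (∀ j' : Fin n, j' < j → R i j' = 0) → R i j ≠ 0 →
    (R i j).im = 0 ∧ 0 < (R i j).re)

theorem exists_unitary_sub_mem_and_notMem {n : Type*} [Fintype n] [DecidableEq n]
    {F G : Submodule ℂ (n → ℂ)} (hGF : G < F) {a : n → ℂ} (ha0 : a ≠ 0) :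
    ∃ Y : Matrix n n ℂ, Yᴴ * Y = 1 ∧ (∀ v, Y *ᵥ v - v ∈ F) ∧
      (∀ v, (∀ d ∈ F, star d ⬝ᵥ v = 0) → Y *ᵥ v = v) ∧ Y *ᵥ a ∉ G := by
  by_cases haG : a ∈ G
  · obtain ⟨u, huF, huG⟩ := SetLike.exists_of_lt hGF
    obtain ⟨d, hdF, hdG, hda⟩ : ∃ d ∈ F, d ∉ G ∧ star d ⬝ᵥ a ≠ 0 := by
      by_cases hua : star u ⬝ᵥ a = 0
      · refine ⟨u + a, F.add_mem huF (hGF.le haG), fun h => huG ?_, ?_⟩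
        · simpa using G.sub_mem h haG
        · simpa [add_dotProduct, hua] using ha0
      · exact ⟨u, huF, huG, hua⟩
    have hd0 : star d ⬝ᵥ d ≠ 0 := by
      rw [Ne, dotProduct_star_self_eq_zero]
      rintro rfl
      exact hdG G.zero_mem
    have hmul : ∀ v, (1 - (2 / (star d ⬝ᵥ d)) • vecMulVec d (star d)) *ᵥ v
        = v - (2 / (star d ⬝ᵥ d) * (star d ⬝ᵥ v)) • d := by
      intro v
      rw [sub_mulVec, one_mulVec, smul_mulVec, vecMulVec_mulVec, mul_smul, op_smul_eq_smul]
    have hstar : star (star d ⬝ᵥ d) = star d ⬝ᵥ d := by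
      exact (star_dotProduct d d).symm
    refine ⟨1 - (2 / (star d ⬝ᵥ d)) • vecMulVec d (star d), ?_, ?_, ?_, ?_⟩
    · rw [conjTranspose_sub, conjTranspose_one, conjTranspose_smul, conjTranspose_vecMulVec,
        star_star, star_div₀, hstar]
      have hc : 2 / (star d ⬝ᵥ d) * (2 / (star d ⬝ᵥ d) * (star d ⬝ᵥ d))
          = 2 * (2 / (star d ⬝ᵥ d)) := by field_simp
      have hsq : vecMulVec d (star d) * vecMulVec d (star d)
          = (star d ⬝ᵥ d) • vecMulVec d (star d) := by
        rw [vecMulVec_mul_vecMulVec, vecMulVec_smul]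
      simp only [sub_mul, mul_sub, one_mul, mul_one, smul_mul_assoc, mul_smul_comm, hsq,
        smul_smul, star_ofNat]
      match_scalars
      · ring
      · linear_combination hc
    · intro v
      rw [hmul, sub_sub_cancel_left]
      exact F.neg_mem (F.smul_mem _ hdF)
    · intro v hv
      rw [hmul, hv d hdF, mul_zero, zero_smul, sub_zero]
    · rw [hmul]
      intro h
      have h2 : (2 / (star d ⬝ᵥ d) * (star d ⬝ᵥ a)) • d ∈ G := by simpa using G.sub_mem haG h
      exact hdG ((G.smul_mem_iff (by simp [hd0, hda])).1 h2)
  · exact ⟨1, by simp, by simp, by simp, by simpa using haG⟩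

theorem exists_unitaries_no_invariant_submodule {n ι : Type*} [Fintype n] [DecidableEq n]
    (F : Submodule ℂ (n → ℂ)) (A : ι → Matrix n n ℂ) (hA : ∀ v ≠ 0, ∃ k, A k *ᵥ v ≠ 0)
    (hF : ∃ k, ∃ v ∈ F, A k *ᵥ v ∉ F) :
    ∃ X : ι → Matrix n n ℂ, (∀ k, (X k)ᴴ * X k = 1) ∧ (∀ k v, X k *ᵥ v - v ∈ F) ∧
      (∀ k v, (∀ d ∈ F, star d ⬝ᵥ v = 0) → X k *ᵥ v = v) ∧
      ∀ W ≤ F, (∀ k, ∀ w ∈ W, (X k * A k) *ᵥ w ∈ W) → W = ⊥ := by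
  classical
  induction F using WellFoundedLT.induction generalizing A with
  | ind F ih =>
  let G : Submodule ℂ (n → ℂ) := F ⊓ ⨅ k, F.comap (A k).mulVecLin
  have hmemG : ∀ v, v ∈ G ↔ v ∈ F ∧ ∀ k, A k *ᵥ v ∈ F := by
    intro v
    simp [G, Submodule.mem_iInf]
  have hGF : G < F := by
    obtain ⟨k, v, hv, hkv⟩ := hF
    exact SetLike.lt_iff_le_and_exists.2
      ⟨inf_le_left, v, hv, fun h => hkv (((hmemG v).1 h).2 k)⟩
  by_cases hG : G = ⊥
  · refine ⟨fun _ => 1, by simp, by simp, by simp, fun W hWF hW => ?_⟩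
    rw [eq_bot_iff, ← hG]
    exact fun w hw => (hmemG w).2 ⟨hWF hw, fun k => hWF (by simpa using hW k w hw)⟩
  · obtain ⟨v, hvG, hv0⟩ := Submodule.exists_mem_ne_zero_of_ne_bot hG
    obtain ⟨k, hk⟩ := hA v hv0
    obtain ⟨Y, hYu, hYF, hYfix, hYa⟩ := exists_unitary_sub_mem_and_notMem hGF hk
    let Z : ι → Matrix n n ℂ := fun j => if j = k then Y else 1
    have hZu : ∀ j, (Z j)ᴴ * Z j = 1 := by
      intro j; by_cases hj : j = k <;> simp [Z, hj, hYu]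
    have hZF : ∀ j v, Z j *ᵥ v - v ∈ F := by
      intro j; by_cases hj : j = k <;> simp [Z, hj, hYF]
    have hZfix : ∀ j v, (∀ d ∈ F, star d ⬝ᵥ v = 0) → Z j *ᵥ v = v := by
      intro j; by_cases hj : j = k
      · simpa [Z, hj] using hYfix
      · simp [Z, hj]
    obtain ⟨X, hXu, hXG, hXfix, hXW⟩ := ih G hGF (fun j => Z j * A j)
      (fun w hw => by
        obtain ⟨j, hj⟩ := hA w hw
        refine ⟨j, fun h => hj ?_⟩
        have := congrArg ((Z j)ᴴ *ᵥ ·) h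
        simpa [mulVec_mulVec, ← Matrix.mul_assoc, hZu] using this)
      ⟨k, v, hvG, by simpa [Z] using hYa⟩
    have hXZF : ∀ j w, (X j * Z j) *ᵥ w - w ∈ F := fun j w => by
      have := F.add_mem (hGF.le (hXG j (Z j *ᵥ w))) (hZF j w)
      simpa [mulVec_mulVec] using this
    refine ⟨fun j => X j * Z j, fun j => ?_, hXZF, fun j w hw => ?_, fun W hWF hW => ?_⟩
    · rw [conjTranspose_mul, Matrix.mul_assoc, ← Matrix.mul_assoc _ (X j), hXu, Matrix.one_mul,
        hZu]
    · rw [← mulVec_mulVec, hZfix j w hw, hXfix j w fun d hd => hw d (hGF.le hd)]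
    · refine hXW W (fun w hw => (hmemG w).2 ⟨hWF hw, fun j => ?_⟩) fun j w hw => ?_
      · have h1 := hWF (hW j w hw)
        have h2 := F.sub_mem h1 (hXZF j (A j *ᵥ w))
        simpa [mulVec_mulVec] using h2
      · simpa [Matrix.mul_assoc] using hW j w hw

theorem posSemidef_of_tendsto {n : Type*} [Fintype n] {X : ℕ → Matrix n n ℂ} {L : Matrix n n ℂ}
    (hX : ∀ t, (X t).PosSemidef) (h : Tendsto X atTop (nhds L)) : L.PosSemidef := by
  refine .of_dotProduct_mulVec_nonneg ?_ fun v => ?_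
  · refine tendsto_nhds_unique ((Continuous.tendsto (by fun_prop) L).comp h) (h.congr fun t => ?_)
    exact (hX t).isHermitian.symm
  · have hc : Continuous fun Y : Matrix n n ℂ => star v ⬝ᵥ (Y *ᵥ v) := by fun_prop
    exact ge_of_tendsto' ((hc.tendsto L).comp h) fun t => (hX t).dotProduct_mulVec_nonneg v

theorem exists_tendsto_of_posSemidef_sub_succ {n : Type*} [Fintype n] {X : ℕ → Matrix n n ℂ}
    (hX : ∀ t, (X t).PosSemidef) (hanti : ∀ t, (X t - X (t + 1)).PosSemidef) :
    ∃ L, Tendsto X atTop (nhds L) := by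
  classical
  have hquad : ∀ v : n → ℂ, ∃ c, Tendsto (fun t => star v ⬝ᵥ (X t *ᵥ v)) atTop (nhds c) := by
    intro v
    have hre : ∀ t, star v ⬝ᵥ (X t *ᵥ v) = ((star v ⬝ᵥ (X t *ᵥ v)).re : ℂ) := fun t =>
      (Complex.eq_re_of_ofReal_le (r := 0) (by simpa using (hX t).dotProduct_mulVec_nonneg v))
    have hmono : Antitone fun t => (star v ⬝ᵥ (X t *ᵥ v)).re := by
      refine antitone_nat_of_succ_le fun t => ?_
      have := (hanti t).dotProduct_mulVec_nonneg v
      rw [sub_mulVec, dotProduct_sub, sub_nonneg] at this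
      exact (Complex.le_def.1 this).1
    have hbdd : BddBelow (Set.range fun t => (star v ⬝ᵥ (X t *ᵥ v)).re) := by
      refine ⟨0, ?_⟩
      rintro _ ⟨t, rfl⟩
      exact (Complex.le_def.1 ((hX t).dotProduct_mulVec_nonneg v)).1
    refine ⟨_, ((Complex.continuous_ofReal.tendsto _).comp
      (tendsto_atTop_ciInf hmono hbdd)).congr fun t => (hre t).symm⟩
  choose q hq using hquad
  have hentry : ∀ i j, ∃ c, Tendsto (fun t => X t i j) atTop (nhds c) := by
    intro i j
    have h1 := hq (Pi.single i 1 + Pi.single j 1)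
    have h2 := hq (Pi.single i 1 + Pi.single j Complex.I)
    have hi := hq (Pi.single i 1)
    have hj := hq (Pi.single j 1)
    refine ⟨_, (((h1.sub hi).sub hj).sub (((h2.sub hi).sub hj).mul_const Complex.I)).div_const 2
      |>.congr fun t => ?_⟩
    simp [star_add, mulVec_add, add_dotProduct]
    ring_nf
    simp
    ring
  choose c hc using hentry
  exact ⟨Matrix.of c, tendsto_pi_nhds.2 fun i => tendsto_pi_nhds.2 fun j => hc i j⟩

theorem eq_zero_of_fixed_point {n ι : Type*} [Fintype n] [DecidableEq n] [Fintype ι]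
    {A : ι → Matrix n n ℂ} (hA : ∑ k, (A k)ᴴ * A k = 1) {P L : Matrix n n ℂ}
    (hL : L.PosSemidef) (hPL : (P - L).PosSemidef)
    (hfix : ∑ k, (A k)ᴴ * L * A k = L)
    (hinv : ∀ W : Submodule ℂ (n → ℂ), (∀ w ∈ W, ∀ v, P *ᵥ v = 0 → star v ⬝ᵥ w = 0) →
      (∀ k, ∀ w ∈ W, A k *ᵥ w ∈ W) → W = ⊥) : L = 0 := by
  by_contra hL0
  have hev : hL.isHermitian.eigenvalues ≠ 0 := fun h =>
    hL0 (hL.isHermitian.eigenvalues_eq_zero_iff.1 h)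
  obtain ⟨i₁, hi₁⟩ := Function.ne_iff.1 hev
  have : Nonempty n := ⟨i₁⟩
  obtain ⟨i₀, hi₀⟩ := Finite.exists_max hL.isHermitian.eigenvalues
  set e := hL.isHermitian.eigenvalues with he
  have hpos : 0 < e i₀ :=
    ((hL.eigenvalues_nonneg i₁).lt_of_ne' hi₁).trans_le (hi₀ i₁)
  have hN : ((e i₀ : ℂ) • (1 : Matrix n n ℂ) - L).PosSemidef := by
    have hV : (hL.isHermitian.eigenvectorUnitary : Matrix n n ℂ)
        * (hL.isHermitian.eigenvectorUnitary : Matrix n n ℂ)ᴴ = 1 :=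
      Unitary.mul_star_self_of_mem hL.isHermitian.eigenvectorUnitary.2
    have hD : (diagonal fun i => (e i₀ : ℂ) - e i).PosSemidef :=
      .diagonal fun i => by simpa using hi₀ i
    convert hD.mul_mul_conjTranspose_same (hL.isHermitian.eigenvectorUnitary : Matrix n n ℂ)
      using 1
    rw [← diagonal_sub, mul_sub, sub_mul]
    congr 1
    · rw [← smul_one_eq_diagonal, Matrix.mul_smul, Matrix.mul_one, Matrix.smul_mul, hV]
    · exact hL.isHermitian.spectral_theorem
  set N := (e i₀ : ℂ) • (1 : Matrix n n ℂ) - L with hNdef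
  have hNfix : ∑ k, (A k)ᴴ * N * A k = N := by
    simp only [hNdef, mul_sub, sub_mul, Finset.sum_sub_distrib, hfix, Matrix.mul_smul,
      Matrix.smul_mul, Matrix.mul_one, ← Finset.smul_sum, hA]
  have hker : ∀ v, P *ᵥ v = 0 → L *ᵥ v = 0 := by
    intro v hv
    rw [← hL.dotProduct_mulVec_zero_iff]
    refine le_antisymm ?_ (hL.dotProduct_mulVec_nonneg v)
    simpa [sub_mulVec, hv] using hPL.dotProduct_mulVec_nonneg v
  have hW := hinv (LinearMap.ker N.mulVecLin) ?_ ?_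
  · have hmem : (hL.isHermitian.eigenvectorBasis i₀).ofLp ∈ LinearMap.ker N.mulVecLin := by
      rw [LinearMap.mem_ker, mulVecLin_apply, hNdef, sub_mulVec,
        hL.isHermitian.mulVec_eigenvectorBasis, smul_mulVec, one_mulVec, sub_eq_zero]
      simp [he]
    rw [hW, Submodule.mem_bot] at hmem
    exact hL.isHermitian.eigenvectorBasis.orthonormal.ne_zero i₀ (by simpa using hmem)
  · intro w hw v hv
    have hLw : L *ᵥ w = (e i₀ : ℂ) • w := by
      rw [LinearMap.mem_ker, mulVecLin_apply, hNdef, sub_mulVec, smul_mulVec, one_mulVec,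
        sub_eq_zero] at hw
      exact hw.symm
    have h1 : star v ⬝ᵥ (L *ᵥ w) = 0 := by
      rw [dotProduct_mulVec, ← hL.isHermitian.eq, ← star_mulVec, hker v hv, star_zero,
        zero_dotProduct]
    rw [hLw, dotProduct_smul, smul_eq_mul] at h1
    simpa [hpos.ne'] using h1
  · intro k w hw
    rw [LinearMap.mem_ker, mulVecLin_apply] at hw ⊢
    have hterm : ∀ j, star w ⬝ᵥ (((A j)ᴴ * N * A j) *ᵥ w)
        = star (A j *ᵥ w) ⬝ᵥ (N *ᵥ (A j *ᵥ w)) := by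
      intro j
      rw [star_mulVec, ← dotProduct_mulVec, mulVec_mulVec, mulVec_mulVec, Matrix.mul_assoc]
    have hsum : ∑ j, star (A j *ᵥ w) ⬝ᵥ (N *ᵥ (A j *ᵥ w)) = 0 := by
      simp_rw [← hterm]
      rw [← dotProduct_sum, ← sum_mulVec, hNfix, hw, dotProduct_zero]
    rw [← hN.dotProduct_mulVec_zero_iff]
    exact (Finset.sum_eq_zero_iff_of_nonneg fun j _ => hN.dotProduct_mulVec_nonneg _).1 hsum k
      (Finset.mem_univ k)

theorem tendsto_trace_mul_iterate {n ι : Type*} [Fintype n] [DecidableEq n] [Fintype ι]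
    {A : ι → Matrix n n ℂ} (hA : ∑ k, (A k)ᴴ * A k = 1) {P : Matrix n n ℂ}
    (hP : P.PosSemidef) (hdec : (P - ∑ k, (A k)ᴴ * P * A k).PosSemidef)
    (hinv : ∀ W : Submodule ℂ (n → ℂ), (∀ w ∈ W, ∀ v, P *ᵥ v = 0 → star v ⬝ᵥ w = 0) →
      (∀ k, ∀ w ∈ W, A k *ᵥ w ∈ W) → W = ⊥) (ρ : Matrix n n ℂ) :
    Tendsto (fun t : ℕ => (P * (fun σ => ∑ k, A k * σ * (A k)ᴴ)^[t] ρ).trace) atTop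
      (nhds 0) := by
  set Ψ : Matrix n n ℂ → Matrix n n ℂ := fun σ => ∑ k, A k * σ * (A k)ᴴ with hΨ
  set Φ : Matrix n n ℂ → Matrix n n ℂ := fun X => ∑ k, (A k)ᴴ * X * A k with hΦ
  have hstep : ∀ X σ, (X * Ψ σ).trace = (Φ X * σ).trace := by
    intro X σ
    simp only [hΨ, hΦ, Finset.mul_sum, Finset.sum_mul, trace_sum]
    refine Finset.sum_congr rfl fun k _ => ?_
    rw [← Matrix.mul_assoc, trace_mul_comm]
    simp only [Matrix.mul_assoc]
  have hdual : ∀ t σ, (P * Ψ^[t] σ).trace = (Φ^[t] P * σ).trace := by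
    intro t
    induction t with
    | zero => simp
    | succ t ih =>
      intro σ
      rw [Function.iterate_succ_apply, ih, hstep, ← Function.iterate_succ_apply' Φ]
  have hΦpos : ∀ X, X.PosSemidef → (Φ X).PosSemidef := fun X hX =>
    posSemidef_sum _ fun k _ => hX.conjTranspose_mul_mul_same (A k)
  have hΦsub : ∀ X Y, Φ X - Φ Y = Φ (X - Y) := fun X Y => by
    simp only [hΦ, mul_sub, sub_mul, Finset.sum_sub_distrib]
  have hΦcont : Continuous Φ := by fun_prop
  have hXpos : ∀ t, (Φ^[t] P).PosSemidef := by
    intro t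
    induction t with
    | zero => exact hP
    | succ t ih => rw [Function.iterate_succ_apply']; exact hΦpos _ ih
  have hXanti : ∀ t, (Φ^[t] P - Φ^[t + 1] P).PosSemidef := by
    intro t
    induction t with
    | zero => exact hdec
    | succ t ih =>
      rw [Function.iterate_succ_apply' Φ t, Function.iterate_succ_apply' Φ (t + 1), hΦsub]
      exact hΦpos _ ih
  have hXle : ∀ t, (P - Φ^[t] P).PosSemidef := by
    intro t
    induction t with
    | zero => simpa using PosSemidef.zero
    | succ t ih => simpa using ih.add (hXanti t)
  obtain ⟨L, hL⟩ := exists_tendsto_of_posSemidef_sub_succ hXpos hXanti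
  have hfix : Φ L = L := by
    refine tendsto_nhds_unique ((hΦcont.tendsto L).comp hL) ?_
    refine ((tendsto_add_atTop_iff_nat 1).2 hL).congr fun t => ?_
    rw [Function.iterate_succ_apply', Function.comp_apply]
  have hL0 : L = 0 := eq_zero_of_fixed_point hA (posSemidef_of_tendsto hXpos hL)
    (posSemidef_of_tendsto hXle (hL.const_sub P)) hfix hinv
  have hc : Continuous fun Y : Matrix n n ℂ => (Y * ρ).trace := by fun_prop
  have := (hc.tendsto L).comp hL
  rw [hL0, Matrix.zero_mul, trace_zero] at this
  exact this.congr fun t => (hdual t ρ).symm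

theorem colRank_succ_le {n : ℕ} (A : Matrix (Fin n) (Fin n) ℂ) (j : Fin n) :
    colRank n A (j + 1) ≤ colRank n A j + 1 ∧
      (Aᵀ j = 0 → colRank n A (j + 1) = colRank n A j) := by
  have h : (fun l => Aᵀ l) '' {l : Fin n | (l : ℕ) < j + 1}
      = insert (Aᵀ j) ((fun l => Aᵀ l) '' {l : Fin n | (l : ℕ) < j}) := by
    have hset : {l : Fin n | (l : ℕ) < j + 1} = insert j {l : Fin n | (l : ℕ) < j} := by
      ext l
      simp only [Set.mem_ofPred_eq, Set.mem_insert_iff, Fin.ext_iff]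
      omega
    rw [hset]
    exact Set.image_insert_eq
  rw [colRank, colRank, h]
  refine ⟨?_, fun h0 => by rw [h0, Submodule.span_insert_zero]⟩
  rw [Submodule.span_insert]
  refine (Submodule.finrank_add_le_finrank_add_finrank _ _).trans ?_
  have := finrank_span_le_card (R := ℂ) ({Aᵀ j} : Set (Fin n → ℂ))
  rw [Set.toFinset_singleton, Finset.card_singleton] at this
  omega

theorem colRank_lt_of_mulVec_append_eq_zero {m r : ℕ}
    {A : Matrix (Fin (m + r)) (Fin (m + r)) ℂ} {c : Fin m → ℂ} (hc : c ≠ 0)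
    (h : A *ᵥ Fin.append c 0 = 0) : colRank (m + r) A m < m := by
  by_contra hlt
  have hrange : (fun l => Aᵀ l) '' {l : Fin (m + r) | (l : ℕ) < m}
      = Set.range fun i : Fin m => Aᵀ (Fin.castAdd r i) := by
    ext v
    constructor
    · rintro ⟨l, hl, rfl⟩
      exact ⟨⟨l, hl⟩, rfl⟩
    · rintro ⟨i, rfl⟩
      exact ⟨Fin.castAdd r i, i.2, rfl⟩
  have hli : LinearIndependent ℂ fun i : Fin m => Aᵀ (Fin.castAdd r i) := by
    rw [linearIndependent_iff_card_le_finrank_span, Fintype.card_fin, Set.finrank, ← hrange]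
    exact not_lt.1 hlt
  refine hc (funext (Fintype.linearIndependent_iff.1 hli c ?_))
  ext i
  have := congrFun h i
  simpa [mulVec, dotProduct, Fin.sum_univ_add, mul_comm] using this

theorem IsCanonicalQR.upper {m r : ℕ} {A Q R : Matrix (Fin (m + r)) (Fin (m + r)) ℂ}
    (h : IsCanonicalQR (m + r) A Q R) (i : Fin r) (j : Fin m) :
    R (Fin.natAdd m i) (Fin.castAdd r j) = 0 := by
  refine h.2.2.1 _ _ ?_
  have hle : ∀ t : ℕ, t ≤ m + r → colRank (m + r) A t ≤ t := by
    intro t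
    induction t with
    | zero => simp [colRank]
    | succ t ih =>
      intro ht
      exact ((colRank_succ_le A ⟨t, ht⟩).1).trans (Nat.succ_le_succ (ih (by omega)))
  refine (hle _ ?_).trans ?_ <;> simp <;> omega

theorem IsCanonicalQR.col_eq_zero {m r : ℕ} {A Q R : Matrix (Fin (m + r)) (Fin (m + r)) ℂ}
    (h : IsCanonicalQR (m + r) A Q R)
    (hRP : ∀ (i : Fin m) (j : Fin r), R (Fin.castAdd r i) (Fin.natAdd m j) = 0)
    (hlt : colRank (m + r) A m < m) (j : Fin r) : Aᵀ (Fin.natAdd m j) = 0 := by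
  have hcol : ∀ j : Fin r, colRank (m + r) A (m + j) < m → Aᵀ (Fin.natAdd m j) = 0 := by
    intro j hj
    have hR : ∀ l, R l (Fin.natAdd m j) = 0 := by
      intro l
      induction l using Fin.addCases with
      | left i => exact hRP i j
      | right i =>
        refine h.2.2.1 _ _ (((colRank_succ_le A (Fin.natAdd m j)).1).trans ?_)
        simp only [Fin.val_natAdd]
        omega
    ext i
    rw [transpose_apply, h.2.1, mul_apply]
    simp [hR]
  have hrank : ∀ t : ℕ, t ≤ r → colRank (m + r) A (m + t) < m := by
    intro t
    induction t with
    | zero => simpa using hlt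
    | succ t ih =>
      intro ht
      have ht' := ih (by omega)
      exact ((colRank_succ_le A (Fin.natAdd m ⟨t, ht⟩)).2 (hcol ⟨t, ht⟩ ht')).trans_lt ht'
  exact hcol j (hrank j j.2.le)

theorem IsCanonicalQR.upperRight_eq_zero {m r : ℕ}
    {A Q R U : Matrix (Fin (m + r)) (Fin (m + r)) ℂ} (h : IsCanonicalQR (m + r) A Q R)
    (hRP : ∀ (i : Fin m) (j : Fin r), R (Fin.castAdd r i) (Fin.natAdd m j) = 0)
    (hU : Uᴴ * U = 1)
    (hUA : ∀ (i : Fin r) (j : Fin m), (U * A) (Fin.natAdd m i) (Fin.castAdd r j) = 0)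
    (i : Fin m) (j : Fin r) : (U * A) (Fin.castAdd r i) (Fin.natAdd m j) = 0 := by
  set B := U * A with hB
  by_cases hdet : (B.submatrix (Fin.castAdd r) (Fin.castAdd r)).det = 0
  · obtain ⟨c, hc, hBc⟩ := exists_mulVec_eq_zero_iff.2 hdet
    have hBc' : B *ᵥ Fin.append c 0 = 0 := by
      ext l
      induction l using Fin.addCases with
      | left l => simpa [mulVec, dotProduct, Fin.sum_univ_add] using congrFun hBc l
      | right l => simp [mulVec, dotProduct, Fin.sum_univ_add, hUA]
    have hAc : A *ᵥ Fin.append c 0 = 0 := by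
      have := congrArg (Uᴴ *ᵥ ·) hBc'
      simpa [hB, mulVec_mulVec, ← Matrix.mul_assoc, hU] using this
    have hA := h.col_eq_zero hRP (colRank_lt_of_mulVec_append_eq_zero hc hAc) j
    rw [hB, mul_apply]
    exact Finset.sum_eq_zero fun l _ => by rw [← transpose_apply A, hA, Pi.zero_apply, mul_zero]
  · have hBR : Bᴴ * B = Rᴴ * R := by
      rw [hB, conjTranspose_mul, Matrix.mul_assoc, ← Matrix.mul_assoc _ U, hU, Matrix.one_mul,
        h.2.1, conjTranspose_mul, Matrix.mul_assoc, ← Matrix.mul_assoc _ Q, h.1, Matrix.one_mul]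
    have hdet' : (B.submatrix (Fin.castAdd r) (Fin.castAdd r))ᴴ.det ≠ 0 := by
      rwa [det_conjTranspose, Ne, star_eq_zero]
    have hcol := eq_zero_of_mulVec_eq_zero hdet'
      (v := fun l => B (Fin.castAdd r l) (Fin.natAdd m j)) <| by
        ext l
        have := congrFun (congrFun hBR (Fin.castAdd r l)) (Fin.natAdd m j)
        simpa [mul_apply, Fin.sum_univ_add, hUA, hRP, h.upper, mulVec, dotProduct] using this
    exact congrFun hcol i

theorem lowerLeft_eq_zero_of_invariant {m r : ℕ} {ι : Type*} [Fintype ι]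
    {A : ι → Matrix (Fin (m + r)) (Fin (m + r)) ℂ}
    (h : ∀ ρ : Matrix (Fin (m + r)) (Fin (m + r)) ℂ, ρ.PosSemidef → ρ.trace = 1 →
      (∀ i j : Fin (m + r), m ≤ (i : ℕ) ∨ m ≤ (j : ℕ) → ρ i j = 0) →
      ∀ i j : Fin (m + r), m ≤ (i : ℕ) ∨ m ≤ (j : ℕ) → (∑ k, A k * ρ * (A k)ᴴ) i j = 0)
    (k : ι) (i : Fin r) (j : Fin m) : A k (Fin.natAdd m i) (Fin.castAdd r j) = 0 := by
  have h0 := h (diagonal (Pi.single (Fin.castAdd r j) 1))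
    (.diagonal (Pi.single_nonneg.2 zero_le_one)) (by simp [trace_diagonal])
    (fun a b hab => by
      rw [diagonal_apply]
      split_ifs with hEq
      · subst hEq
        refine Pi.single_eq_of_ne ?_ _
        rintro rfl
        have := j.2
        simp at hab
        omega
      · rfl) (Fin.natAdd m i) (Fin.natAdd m i) (by simp)
  have h1 : ∀ k, (A k * diagonal (Pi.single (Fin.castAdd r j) 1) * (A k)ᴴ :
      Matrix (Fin (m + r)) (Fin (m + r)) ℂ) (Fin.natAdd m i) (Fin.natAdd m i) = A k (Fin.natAdd m i) (Fin.castAdd r j)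
        * star (A k (Fin.natAdd m i) (Fin.castAdd r j)) := by
    intro k
    rw [mul_apply]
    simp only [mul_diagonal, conjTranspose_apply]
    rw [Finset.sum_eq_single (Fin.castAdd r j)] <;> simp +contextual
  rw [Matrix.sum_apply] at h0
  simp only [h1] at h0
  have := (Finset.sum_eq_zero_iff_of_nonneg fun k _ => mul_star_self_nonneg _).1 h0 k
    (Finset.mem_univ k)
  simpa using this

/-- The orthogonal projection onto the last `r` coordinates. -/
noncomputable def lowerProj (m r : ℕ) : Matrix (Fin (m + r)) (Fin (m + r)) ℂ :=
  diagonal fun i => if m ≤ (i : ℕ) then 1 else 0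

theorem lowerProj_commute {m r : ℕ} {A : Matrix (Fin (m + r)) (Fin (m + r)) ℂ}
    (hQ : ∀ (i : Fin r) (j : Fin m), A (Fin.natAdd m i) (Fin.castAdd r j) = 0)
    (hP : ∀ (i : Fin m) (j : Fin r), A (Fin.castAdd r i) (Fin.natAdd m j) = 0) :
    lowerProj m r * A = A * lowerProj m r := by
  ext a b
  rw [lowerProj, diagonal_mul, mul_diagonal]
  have hlt : ∀ i : Fin m, ¬ m ≤ (i : ℕ) := fun i => not_le.2 i.2
  induction a using Fin.addCases <;> induction b using Fin.addCases <;> simp [hQ, hP, hlt]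

theorem lowerProj_mul_mul {m r : ℕ} {A : Matrix (Fin (m + r)) (Fin (m + r)) ℂ}
    (hQ : ∀ (i : Fin r) (j : Fin m), A (Fin.natAdd m i) (Fin.castAdd r j) = 0) :
    lowerProj m r * A * lowerProj m r = lowerProj m r * A := by
  ext a b
  rw [lowerProj, mul_diagonal, diagonal_mul]
  induction a using Fin.addCases <;> induction b using Fin.addCases <;> simp [hQ]

theorem lowerProj_mul_self (m r : ℕ) : lowerProj m r * lowerProj m r = lowerProj m r := by
  simp [lowerProj]

theorem lowerProj_posSemidef (m r : ℕ) : (lowerProj m r).PosSemidef :=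
  .diagonal fun i => by dsimp only; split_ifs <;> simp

theorem one_sub_lowerProj_posSemidef (m r : ℕ) : (1 - lowerProj m r).PosSemidef := by
  rw [lowerProj, ← diagonal_one, diagonal_sub]
  exact .diagonal fun i => by dsimp only; split_ifs <;> simp

theorem lowerProj_sub_posSemidef {m r : ℕ} {ι : Type*} [Fintype ι]
    {A : ι → Matrix (Fin (m + r)) (Fin (m + r)) ℂ} (hA : ∑ k, (A k)ᴴ * A k = 1)
    (hQ : ∀ k (i : Fin r) (j : Fin m), A k (Fin.natAdd m i) (Fin.castAdd r j) = 0) :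
    (lowerProj m r - ∑ k, (A k)ᴴ * lowerProj m r * A k).PosSemidef := by
  have hPh : (lowerProj m r)ᴴ = lowerProj m r := (lowerProj_posSemidef m r).isHermitian
  have hterm : ∀ k, (A k)ᴴ * lowerProj m r * A k
      = (lowerProj m r)ᴴ * ((A k)ᴴ * lowerProj m r * A k) * lowerProj m r := by
    intro k
    calc (A k)ᴴ * lowerProj m r * A k
        = (lowerProj m r * A k)ᴴ * (lowerProj m r * A k) := by
          simp only [conjTranspose_mul, hPh, Matrix.mul_assoc]
          rw [← Matrix.mul_assoc (lowerProj m r) (lowerProj m r), lowerProj_mul_self]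
      _ = (lowerProj m r * A k * lowerProj m r)ᴴ * (lowerProj m r * A k * lowerProj m r) := by
          rw [lowerProj_mul_mul (hQ k)]
      _ = _ := by
          simp only [conjTranspose_mul, hPh, Matrix.mul_assoc]
          rw [← Matrix.mul_assoc (lowerProj m r) (lowerProj m r), lowerProj_mul_self]
  have hpsd : ((lowerProj m r)ᴴ * (∑ k, (A k)ᴴ * (1 - lowerProj m r) * A k)
      * lowerProj m r).PosSemidef :=
    (posSemidef_sum _ fun k _ => (one_sub_lowerProj_posSemidef m r).conjTranspose_mul_mul_same
      (A k)).conjTranspose_mul_mul_same _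
  convert hpsd using 1
  rw [Finset.sum_congr rfl fun k _ => hterm k]
  simp only [mul_sub, sub_mul, Matrix.mul_one,
    Finset.sum_sub_distrib, hA, hPh, lowerProj_mul_self, Finset.mul_sum, Finset.sum_mul]

theorem trace_lowerProj_mul_iterate {m r : ℕ} {ι : Type*} [Fintype ι]
    {A : ι → Matrix (Fin (m + r)) (Fin (m + r)) ℂ} (hA : ∑ k, (A k)ᴴ * A k = 1)
    (hcomm : ∀ k, lowerProj m r * A k = A k * lowerProj m r)
    {ρ : Matrix (Fin (m + r)) (Fin (m + r)) ℂ} (hρ : lowerProj m r * ρ = ρ) (t : ℕ) :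
    (lowerProj m r * (fun σ => ∑ k, A k * σ * (A k)ᴴ)^[t] ρ).trace = ρ.trace := by
  induction t generalizing ρ with
  | zero => simp [hρ]
  | succ t ih =>
    rw [Function.iterate_succ_apply, ih]
    · simp only [trace_sum]
      simp_rw [fun k => trace_mul_comm (A k * ρ) (A k)ᴴ, ← Matrix.mul_assoc]
      rw [← trace_sum, ← Finset.sum_mul, hA, Matrix.one_mul]
    · rw [Finset.mul_sum]
      refine Finset.sum_congr rfl fun k _ => ?_
      rw [← Matrix.mul_assoc, ← Matrix.mul_assoc, hcomm, Matrix.mul_assoc (A k), hρ]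

theorem mul_mul_conjTranspose_apply_eq_zero {m r : ℕ}
    {A ρ : Matrix (Fin (m + r)) (Fin (m + r)) ℂ}
    (hA : ∀ (i : Fin r) (j : Fin m), A (Fin.natAdd m i) (Fin.castAdd r j) = 0)
    (hρ : ∀ i j : Fin (m + r), m ≤ (i : ℕ) ∨ m ≤ (j : ℕ) → ρ i j = 0)
    {i j : Fin (m + r)} (hij : m ≤ (i : ℕ) ∨ m ≤ (j : ℕ)) : (A * ρ * Aᴴ) i j = 0 := by
  have hA' : ∀ a b : Fin (m + r), m ≤ (a : ℕ) → ¬ m ≤ (b : ℕ) → A a b = 0 := by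
    intro a b ha hb
    induction a using Fin.addCases with
    | left a => exact absurd ha (not_le.2 a.2)
    | right a =>
      induction b using Fin.addCases with
      | left b => exact hA a b
      | right b => exact absurd (by simp) hb
  simp only [mul_apply, Finset.sum_mul]
  refine Finset.sum_eq_zero fun b _ => Finset.sum_eq_zero fun a _ => ?_
  by_cases hab : m ≤ (a : ℕ) ∨ m ≤ (b : ℕ)
  · simp [hρ a b hab]
  · rw [not_or] at hab
    rcases hij with hi | hj
    · simp [hA' i a hi hab.1]
    · simp [hA' j b hj hab.2]

/-- `H_S` can be made globally asymptotically stable by some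
choice of outcome-dependent unitary controls iff not all the `R_{P,k}` blocks
of the canonical R-factors of the `M_k` vanish. -/
theorem stabilizable_iff_some_RP_nonzero
    (m r K : ℕ) (hr : 0 < r)
    (M Q R : Fin K → Matrix (Fin (m + r)) (Fin (m + r)) ℂ)
    (hTP : ∑ k, (M k)ᴴ * M k = 1)
    (hQR : ∀ k, IsCanonicalQR (m + r) (M k) (Q k) (R k)) :
    (∃ U : Fin K → Matrix (Fin (m + r)) (Fin (m + r)) ℂ,
      (∀ k, (U k)ᴴ * U k = 1) ∧
      (∀ ρ : Matrix (Fin (m + r)) (Fin (m + r)) ℂ,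
        ρ.PosSemidef → ρ.trace = 1 →
        (∀ i j : Fin (m + r), m ≤ (i : ℕ) ∨ m ≤ (j : ℕ) → ρ i j = 0) →
        (∀ i j : Fin (m + r), m ≤ (i : ℕ) ∨ m ≤ (j : ℕ) →
          (∑ k, U k * M k * ρ * (M k)ᴴ * (U k)ᴴ) i j = 0)) ∧
      (∀ ρ : Matrix (Fin (m + r)) (Fin (m + r)) ℂ,
        ρ.PosSemidef → ρ.trace = 1 →
        Tendsto
          (fun t : ℕ =>
            (Matrix.diagonal (fun i : Fin (m + r) => if m ≤ (i : ℕ) then (1 : ℂ) else 0) *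
              ((fun σ => ∑ k, U k * M k * σ * (M k)ᴴ * (U k)ᴴ)^[t] ρ)).trace)
          atTop (nhds 0))) ↔
    ¬ (∀ k, ∀ (i : Fin m) (j : Fin r),
        R k (Fin.castAdd r i) (Fin.natAdd m j) = 0) := by
  have hQu : ∀ k, (Q k)ᴴ * Q k = 1 := fun k => (hQR k).1
  have hRTP : ∑ k, (R k)ᴴ * R k = 1 := by
    rw [← hTP]
    refine Finset.sum_congr rfl fun k _ => ?_
    rw [(hQR k).2.1, conjTranspose_mul, Matrix.mul_assoc, ← Matrix.mul_assoc _ (Q k), hQu,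
      Matrix.one_mul]
  have hconj : ∀ (U : Fin K → Matrix (Fin (m + r)) (Fin (m + r)) ℂ) σ,
      ∑ k, U k * M k * σ * (M k)ᴴ * (U k)ᴴ = ∑ k, (U k * M k) * σ * (U k * M k)ᴴ := by
    intro U σ
    simp only [conjTranspose_mul, Matrix.mul_assoc]
  have hUTP : ∀ U : Fin K → Matrix (Fin (m + r)) (Fin (m + r)) ℂ, (∀ k, (U k)ᴴ * U k = 1) →
      ∑ k, (U k * M k)ᴴ * (U k * M k) = 1 := by
    intro U hU
    rw [← hTP]
    refine Finset.sum_congr rfl fun k _ => ?_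
    rw [conjTranspose_mul, Matrix.mul_assoc, ← Matrix.mul_assoc _ (U k), hU, Matrix.one_mul]
  constructor
  · rintro ⟨U, hU, hUinv, hUattr⟩ hRP
    simp only [hconj] at hUinv hUattr
    have hQ := lowerLeft_eq_zero_of_invariant hUinv
    have hcomm : ∀ k, lowerProj m r * (U k * M k) = (U k * M k) * lowerProj m r := fun k =>
      lowerProj_commute (hQ k) ((hQR k).upperRight_eq_zero (hRP k) (hU k) (hQ k))
    let i₀ : Fin (m + r) := Fin.natAdd m ⟨0, hr⟩
    have htr : (diagonal (Pi.single i₀ (1 : ℂ))).trace = 1 := by simp [trace_diagonal]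
    have hlim := hUattr (diagonal (Pi.single i₀ 1)) (.diagonal (Pi.single_nonneg.2 zero_le_one))
      htr
    have hρ : lowerProj m r * diagonal (Pi.single i₀ 1) = diagonal (Pi.single i₀ 1) := by
      rw [lowerProj, diagonal_mul_diagonal]
      congr 1
      ext i
      by_cases hi : i = i₀
      · subst hi
        simp [i₀]
      · simp [hi]
    have hconst := trace_lowerProj_mul_iterate (hUTP U hU) hcomm hρ
    rw [htr] at hconst
    exact one_ne_zero (tendsto_nhds_unique tendsto_const_nhds (hlim.congr hconst))
  · intro hRP
    push Not at hRP
    obtain ⟨k₀, i₀, j₀, hne⟩ := hRP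
    let F : Submodule ℂ (Fin (m + r) → ℂ) :=
      ⨅ i : Fin m, LinearMap.ker (LinearMap.proj (Fin.castAdd r i))
    have hF : ∀ v, v ∈ F ↔ ∀ i : Fin m, v (Fin.castAdd r i) = 0 := by
      intro v
      simp [F, Submodule.mem_iInf]
    have hsingle : Pi.single (Fin.natAdd m j₀) 1 ∈ F := (hF _).2 fun i =>
      Pi.single_eq_of_ne (Fin.ne_of_lt (Nat.lt_add_right _ i.2)) _
    obtain ⟨X, hXu, -, hXfix, hXW⟩ := exists_unitaries_no_invariant_submodule F R
      (fun v hv => by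
        by_contra! h
        refine hv ?_
        rw [← one_mulVec v, ← hRTP, sum_mulVec]
        exact Finset.sum_eq_zero fun k _ => by rw [← mulVec_mulVec, h, mulVec_zero])
      ⟨k₀, Pi.single (Fin.natAdd m j₀) 1, hsingle, fun h =>
        hne (by simpa using (hF _).1 h i₀)⟩
    have hXM : ∀ k, X k * (Q k)ᴴ * M k = X k * R k := fun k => by
      rw [(hQR k).2.1, Matrix.mul_assoc, ← Matrix.mul_assoc _ (Q k), hQu, Matrix.one_mul]
    have hU : ∀ k, (X k * (Q k)ᴴ)ᴴ * (X k * (Q k)ᴴ) = 1 := fun k => by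
      rw [conjTranspose_mul, Matrix.mul_assoc, ← Matrix.mul_assoc _ (X k), hXu, Matrix.one_mul,
        conjTranspose_conjTranspose, mul_eq_one_comm.1 (hQu k)]
    have hTPX := hUTP _ hU
    simp only [hXM] at hTPX
    have hlow : ∀ k (i : Fin r) (j : Fin m),
        (X k * R k) (Fin.natAdd m i) (Fin.castAdd r j) = 0 := by
      intro k i j
      have hfix := hXfix k (R k *ᵥ Pi.single (Fin.castAdd r j) 1) fun d hd => by
        simp [dotProduct, Fin.sum_univ_add, (hF d).1 hd, (hQR k).upper]
      rw [mulVec_mulVec] at hfix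
      simpa [(hQR k).upper] using congrFun hfix (Fin.natAdd m i)
    have hconjX : ∀ σ, ∑ k, X k * (Q k)ᴴ * M k * σ * (M k)ᴴ * (X k * (Q k)ᴴ)ᴴ
        = ∑ k, (X k * R k) * σ * (X k * R k)ᴴ := fun σ => by
      simpa only [hXM] using hconj (fun k => X k * (Q k)ᴴ) σ
    refine ⟨fun k => X k * (Q k)ᴴ, hU, fun ρ _ _ hρ i j hij => ?_, fun ρ _ _ => ?_⟩
    · rw [hconjX, Matrix.sum_apply]
      exact Finset.sum_eq_zero fun k _ => mul_mul_conjTranspose_apply_eq_zero (hlow k) hρ hij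
    · simp only [hconjX]
      refine tendsto_trace_mul_iterate hTPX (lowerProj_posSemidef m r)
        (lowerProj_sub_posSemidef hTPX hlow) (fun W hWorth hW => hXW W (fun w hw => ?_) hW) ρ
      refine (hF w).2 fun i => ?_
      have := hWorth w hw (Pi.single (Fin.castAdd r i) 1) (by
        ext l
        simp only [lowerProj, mulVec_diagonal, Pi.single_apply, Pi.zero_apply]
        split_ifs with h1 h2
        · subst h2
          exact absurd h1 (not_le.2 i.2)
        all_goals simp)
      simpa using this
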